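/- arXiv:1206.6642 — 2 statements merged into one kernel-verified Lean document; each statement's English description precedes it below -/
import Mathlib

section
/- For every nonnegative integer n, p_8(11n + 4) ≡ 0 (mod 11). -/
/-- `multipartition r n` is the number of `r`-component multipartitions of `n`,
i.e. the number of `r`-tuples of integer partitions whose sizes sum to `n`. -/
def multipartition (r n : ℕ) : ℕ :=
  ∑ c ∈ Finset.Nat.antidiagonalTuple r n, ∏ i, Fintype.card (Nat.Partition (c i))

/-- q-binomial coefficients via Pascal's rule. -/
def gauss {A : Type*} [CommRing A] (q : A) : ℕ → ℕ → A
  | _, 0 => 1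
  | 0, _ + 1 => 0
  | N + 1, k + 1 => q ^ (k + 1) * gauss q N (k + 1) + gauss q N k

/-- q-factorial `∏_{j=1}^n (1 - q^j)`. -/
def qf {A : Type*} [CommRing A] (q : A) (n : ℕ) : A := ∏ j ∈ Finset.range n, (1 - q ^ (j + 1))

section
variable {A : Type*} [CommRing A] (q : A)

lemma gauss_zero_right (N : ℕ) : gauss q N 0 = 1 := by cases N <;> rfl

lemma gauss_eq_zero (N k : ℕ) (h : N < k) : gauss q N k = 0 := by
  induction N generalizing k with
  | zero => obtain ⟨k, rfl⟩ := Nat.exists_eq_add_of_lt h; simp [gauss]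
  | succ N ih =>
    obtain ⟨k, rfl⟩ : ∃ m, k = m + 1 := ⟨k - 1, by omega⟩
    simp [gauss, ih (k + 1) (by omega), ih k (by omega)]

lemma gauss_self (N : ℕ) : gauss q N N = 1 := by
  induction N with
  | zero => rfl
  | succ N ih => simp [gauss, ih, gauss_eq_zero]

lemma qf_succ (n : ℕ) : qf q (n + 1) = qf q n * (1 - q ^ (n + 1)) := by
  simp [qf, Finset.prod_range_succ]

lemma qf_zero : qf q 0 = 1 := by simp [qf]

lemma gauss_mul (N a b : ℕ) (h : a + b = N) : gauss q N a * qf q a * qf q b = qf q N := by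
  induction N generalizing a b with
  | zero =>
    obtain ⟨rfl, rfl⟩ : a = 0 ∧ b = 0 := by omega
    simp [gauss, qf]
  | succ N ih =>
    rcases a with _ | a
    · obtain rfl : b = N + 1 := by omega
      simp [gauss, qf_zero]
    rcases b with _ | b
    · obtain rfl : a = N := by omega
      simp [gauss_self, qf_zero]
    · have h1 := ih (a + 1) b (by omega)
      have h2 := ih a (b + 1) (by omega)
      obtain rfl : N = a + 1 + b := by omega
      rw [qf_succ q b] at *
      rw [qf_succ q a] at *
      rw [gauss, qf_succ q (a + 1 + b)]
      linear_combination (q ^ (a + 1) * (1 - q ^ (b + 1))) * h1 + (1 - q ^ (a + 1)) * h2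

lemma rothe (N : ℕ) (x y : A) :
    ∏ j ∈ Finset.range N, (y + x * q ^ j) =
      ∑ i ∈ Finset.range (N + 1), q ^ (i.choose 2) * gauss q N i * x ^ i * y ^ (N - i) := by
  induction N generalizing x with
  | zero => simp [gauss]
  | succ N ih =>
    rw [Finset.prod_range_succ']
    have : ∀ j, y + x * q ^ (j + 1) = y + (x * q) * q ^ j := fun j => by ring
    simp_rw [this]
    rw [ih]
    conv_rhs => rw [Finset.sum_range_succ']
    simp only [gauss_zero_right, gauss]
    have e1 : ∀ i, q ^ ((i + 1).choose 2) * (q ^ (i + 1) * gauss q N (i + 1) + gauss q N i) *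
        x ^ (i + 1) * y ^ (N + 1 - (i + 1)) =
        q ^ ((i + 1).choose 2) * gauss q N (i + 1) * (x * q) ^ (i + 1) * y ^ (N - i) +
        x * (q ^ (i.choose 2) * gauss q N i * (x * q) ^ i * y ^ (N - i)) := by
      intro i
      have : (i + 1).choose 2 = i + i.choose 2 := by
        rw [Nat.choose_succ_succ' i 1]; simp
      rw [this, Nat.add_sub_add_right]
      ring
    simp_rw [e1]
    rw [Finset.sum_add_distrib, ← Finset.mul_sum, pow_zero, mul_one, mul_add]
    have e2 : ∑ i ∈ Finset.range (N + 1), q ^ ((i + 1).choose 2) * gauss q N (i + 1) *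
          (x * q) ^ (i + 1) * y ^ (N - i) + q ^ (Nat.choose 0 2) * 1 * x ^ 0 * y ^ (N + 1 - 0) =
        (∑ i ∈ Finset.range (N + 1), q ^ (i.choose 2) * gauss q N i * (x * q) ^ i * y ^ (N - i)) * y := by
      rw [Finset.sum_range_succ, gauss_eq_zero q N (N + 1) (by omega), Finset.sum_range_succ',
        add_mul, Finset.sum_mul]
      simp only [gauss_zero_right]
      have : ∀ i ∈ Finset.range N, q ^ ((i + 1).choose 2) * gauss q N (i + 1) *
          (x * q) ^ (i + 1) * y ^ (N - i) = q ^ ((i + 1).choose 2) * gauss q N (i + 1) *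
          (x * q) ^ (i + 1) * y ^ (N - (i + 1)) * y := by
        intro i hi
        have : N - i = N - (i + 1) + 1 := by have := Finset.mem_range.mp hi; omega
        rw [this]; ring
      rw [Finset.sum_congr rfl this]
      simp [pow_succ]
    linear_combination -e2

lemma rothe_deriv (n : ℕ) :
    -q ^ n * ((∏ j ∈ Finset.range n, (q ^ n - q ^ j)) *
      ∏ j ∈ Finset.range n, (q ^ n - q ^ (n + 1 + j))) =
    ∑ i ∈ Finset.range (2 * n + 2), q ^ (i.choose 2) * gauss q (2 * n + 1) i *
      ((-1) ^ i * i) * (q ^ n) ^ (2 * n + 1 - i) := by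
  open Polynomial in
  have h := rothe (C q : A[X]) (2 * n + 1) (-X) (C q ^ n)
  have hg : ∀ N k, gauss (Polynomial.C q) N k = Polynomial.C (gauss q N k) := by
    intro N
    induction N with
    | zero => intro k; cases k <;> simp [gauss]
    | succ N ih => intro k; cases k <;> simp [gauss, ih]
  have h' := congrArg (fun f => Polynomial.eval 1 (Polynomial.derivative f)) h
  simp only [hg] at h'
  have hs : 2 * n + 1 = n + 1 + n := by omega
  have hl : ∏ j ∈ Finset.range (2 * n + 1), (Polynomial.C q ^ n + -Polynomial.X * Polynomial.C q ^ j)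
      = (Polynomial.C (q ^ n) * (1 - Polynomial.X)) *
        ((∏ j ∈ Finset.range n, (Polynomial.C q ^ n + -Polynomial.X * Polynomial.C q ^ j)) *
        ∏ j ∈ Finset.range n, (Polynomial.C q ^ n + -Polynomial.X * Polynomial.C q ^ (n + 1 + j))) := by
    rw [hs, Finset.prod_range_add, Finset.prod_range_succ]
    simp only [map_pow]
    ring
  rw [hl] at h'
  simp only [Polynomial.derivative_mul, Polynomial.eval_add, Polynomial.eval_mul] at h'
  simp only [Polynomial.derivative_C, Polynomial.derivative_sub, Polynomial.derivative_X,
    Polynomial.derivative_one, Polynomial.eval_sub, Polynomial.eval_one, Polynomial.eval_X,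
    Polynomial.eval_C, Polynomial.eval_zero, sub_self, mul_zero, zero_mul, add_zero, zero_add,
    Polynomial.eval_prod, Polynomial.eval_add, Polynomial.eval_mul, Polynomial.eval_neg,
    Polynomial.eval_pow] at h'
  have hq : ∀ (a b : A) (i m : ℕ), Polynomial.eval 1 (Polynomial.derivative
      (Polynomial.C q ^ m * Polynomial.C a * (-Polynomial.X) ^ i * (Polynomial.C q ^ n) ^ (2 * n + 1 - i)))
      = q ^ m * a * ((-1) ^ i * i) * (q ^ n) ^ (2 * n + 1 - i) := by
    intro a b i m
    rw [neg_pow, ← Polynomial.C_pow, ← Polynomial.C_pow, ← Polynomial.C_pow, ← Polynomial.C_mul]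
    have : (-1 : Polynomial A) ^ i = Polynomial.C ((-1) ^ i) := by simp
    rw [this]
    simp only [Polynomial.derivative_mul, Polynomial.derivative_C, Polynomial.derivative_X_pow]
    simp
  rw [Polynomial.derivative_sum, Polynomial.eval_finsetSum] at h'
  simp only [hq _ 0] at h'
  rw [← h']
  simp only [neg_mul, one_mul, ← sub_eq_add_neg]
  ring

end

lemma choose_two_id (m : ℕ) : 2 * m.choose 2 + m = m * m := by
  induction m with
  | zero => simp
  | succ m ih =>
    rw [Nat.choose_succ_succ' m 1]; simp; linarith

lemma exp_id1 (m k : ℕ) : m.choose 2 + (m + k) * (m + k + 1 + k) =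
    (m + k) * (m + k) + (m + k + 1).choose 2 + (k + 1).choose 2 := by
  have h1 := choose_two_id m
  have h2 := choose_two_id (m + k + 1)
  have h3 := choose_two_id (k + 1)
  nlinarith

lemma exp_id2 (m k : ℕ) : (m + k + 1 + k).choose 2 + (m + k) * m =
    (m + k) * (m + k) + (m + k + 1).choose 2 + (k + 1).choose 2 := by
  have h1 := choose_two_id (m + k + 1 + k)
  have h2 := choose_two_id (m + k + 1)
  have h3 := choose_two_id (k + 1)
  nlinarith

lemma gauss_symm {A : Type*} [CommRing A] [IsDomain A] (q : A) (hq : ∀ n, qf q n ≠ 0) (a b : ℕ) :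
    gauss q (a + b) a = gauss q (a + b) b := by
  have h1 := gauss_mul q (a + b) a b rfl
  have h2 := gauss_mul q (a + b) b a (add_comm _ _)
  apply mul_right_cancel₀ (hq a)
  apply mul_right_cancel₀ (hq b)
  linear_combination h1 - h2

lemma prod_sub_one {A : Type*} [CommRing A] (q : A) (n : ℕ) :
    ∏ j ∈ Finset.range n, (q ^ n - q ^ j) = (-1) ^ n * q ^ (n.choose 2) * qf q n := by
  have : ∀ j ∈ Finset.range n, q ^ n - q ^ j = (-1) * q ^ j * (1 - q ^ (n - 1 - j + 1)) := by
    intro j hj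
    have hj := Finset.mem_range.mp hj
    have e : n = j + (n - 1 - j + 1) := by omega
    generalize n - 1 - j + 1 = t at *
    subst e
    ring
  rw [Finset.prod_congr rfl this, Finset.prod_mul_distrib, Finset.prod_mul_distrib,
    Finset.prod_range_reflect (fun j => 1 - q ^ (j + 1)) n, Finset.prod_const, Finset.card_range,
    Finset.prod_pow_eq_pow_sum, Finset.sum_range_id, ← Nat.choose_two_right, qf]

lemma jacobi_fin {A : Type*} [CommRing A] [IsDomain A] (q : A) (h0 : q ≠ 0)
    (hq : ∀ n, qf q n ≠ 0) (n : ℕ) :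
    ∑ k ∈ Finset.range (n + 1), (-1) ^ k * (2 * (k : A) + 1) * q ^ ((k + 1).choose 2) *
      gauss q (2 * n + 1) (n - k) = qf q n * qf q n := by
  have h := rothe_deriv q n
  have hp2 : ∏ j ∈ Finset.range n, (q ^ n - q ^ (n + 1 + j)) = q ^ (n * n) * qf q n := by
    have : ∀ j, q ^ n - q ^ (n + 1 + j) = q ^ n * (1 - q ^ (j + 1)) := fun j => by ring
    simp_rw [this]
    rw [Finset.prod_mul_distrib, Finset.prod_const, Finset.card_range, ← pow_mul, qf]
  rw [prod_sub_one, hp2, show 2 * n + 2 = (n + 1) + (n + 1) by ring, Finset.sum_range_add,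
    ← Finset.sum_range_reflect, ← Finset.sum_add_distrib] at h
  have key : ∀ k ∈ Finset.range (n + 1),
      q ^ ((n + 1 - 1 - k).choose 2) * gauss q (2 * n + 1) (n + 1 - 1 - k) *
        ((-1) ^ (n + 1 - 1 - k) * ((n + 1 - 1 - k : ℕ) : A)) * (q ^ n) ^ (2 * n + 1 - (n + 1 - 1 - k)) +
      q ^ ((n + 1 + k).choose 2) * gauss q (2 * n + 1) (n + 1 + k) *
        ((-1) ^ (n + 1 + k) * ((n + 1 + k : ℕ) : A)) * (q ^ n) ^ (2 * n + 1 - (n + 1 + k)) =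
      ((-1) ^ (n + 1) * q ^ (n * n + (n + 1).choose 2)) * ((-1) ^ k * (2 * (k : A) + 1) *
        q ^ ((k + 1).choose 2) * gauss q (2 * n + 1) (n - k)) := by
    intro k hk
    obtain ⟨m, rfl⟩ : ∃ m, n = m + k := ⟨n - k, by have := Finset.mem_range.mp hk; omega⟩
    have hs := gauss_symm q hq m (m + k + 1 + k)
    rw [show m + (m + k + 1 + k) = 2 * (m + k) + 1 by ring] at hs
    rw [show m + k + 1 - 1 - k = m by omega, show m + k - k = m by omega,
      show 2 * (m + k) + 1 - m = m + k + 1 + k by omega,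
      show 2 * (m + k) + 1 - (m + k + 1 + k) = m by omega, ← hs, ← pow_mul, ← pow_mul]
    have e1 : q ^ (m.choose 2) * q ^ ((m + k) * (m + k + 1 + k)) =
      q ^ ((m + k) * (m + k) + (m + k + 1).choose 2) * q ^ ((k + 1).choose 2) := by
      rw [← pow_add, ← pow_add, exp_id1]
    have e2 : q ^ ((m + k + 1 + k).choose 2) * q ^ ((m + k) * m) =
      q ^ ((m + k) * (m + k) + (m + k + 1).choose 2) * q ^ ((k + 1).choose 2) := by
      rw [← pow_add, ← pow_add, exp_id2]
    have s1 : (-1 : A) ^ (m + k + 1) * (-1) ^ k = - (-1) ^ m := by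
      rw [← pow_add, show m + k + 1 + k = m + 1 + 2 * k by ring, pow_add, pow_mul]; simp [pow_succ]
    have s2 : (-1 : A) ^ (m + k + 1 + k) = - (-1) ^ m := by rw [pow_add, s1]
    rw [s2]
    push_cast
    linear_combination (gauss q (2 * (m + k) + 1) m * (-1) ^ m * m) * e1 -
      gauss q (2 * (m + k) + 1) m * (-1) ^ m * (m + k + 1 + k) * e2 -
      (q ^ ((m + k) * (m + k) + (m + k + 1).choose 2) * q ^ ((k + 1).choose 2) * (2 * k + 1) *
        gauss q (2 * (m + k) + 1) m) * s1
  rw [Finset.sum_congr rfl key, ← Finset.mul_sum] at h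
  have hne : (-1 : A) ^ (n + 1) * q ^ (n * n + (n + 1).choose 2) ≠ 0 := by
    apply mul_ne_zero
    · exact pow_ne_zero _ (by simp)
    · exact pow_ne_zero _ h0
  apply mul_left_cancel₀ hne
  rw [← h, Nat.choose_succ_succ' n 1, Nat.choose_one_right]
  ring

open PowerSeries in
lemma qf_ne_zero (n : ℕ) : qf (X : (ZMod 11)⟦X⟧) n ≠ 0 := by
  have : Fact (Nat.Prime 11) := ⟨by norm_num⟩
  rw [qf, Finset.prod_ne_zero_iff]
  intro j _ h
  have := congrArg constantCoeff h
  simp at this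

/-- partition generating function -/
noncomputable def PP : PowerSeries (ZMod 11) :=
  PowerSeries.mk fun n => (Fintype.card (Nat.Partition n) : ZMod 11)

open PowerSeries in
lemma qf_dvd (n m : ℕ) (h : n ≤ m) : (X : (ZMod 11)⟦X⟧) ^ (n + 1) ∣ qf X m - qf X n := by
  induction m, h using Nat.le_induction with
  | base => simp
  | succ m hm ih =>
    rw [qf_succ]
    have : (X : (ZMod 11)⟦X⟧) ^ (n + 1) ∣ X ^ (m + 1) := pow_dvd_pow _ (by omega)
    have := (ih.sub (this.mul_left (qf X m)))
    convert this using 1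
    ring

open PowerSeries PowerSeries.WithPiTopology in
lemma PP_mul : PP * pentagonalSeries (ZMod 11) = 1 := by
  have : Fact (Nat.Prime 11) := ⟨by norm_num⟩
  let : TopologicalSpace (ZMod 11) := ⊥
  have : DiscreteTopology (ZMod 11) := ⟨rfl⟩
  have h1 := Nat.Partition.hasProd_powerSeriesMk_card_restricted (ZMod 11) (fun _ => True)
  have h2 := hasProd_one_sub_X_pow (ZMod 11)
  have h3 := h1.mul h2
  have e : (PowerSeries.mk fun n ↦ ((Nat.Partition.restricted n (fun _ => True)).card : ZMod 11)) = PP := by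
    simp [PP, Nat.Partition.restricted]
  rw [e] at h3
  simp only [if_true, pow_mul] at h3
  have : ∀ i : ℕ, (∑' j : ℕ, ((X : (ZMod 11)⟦X⟧) ^ (i + 1)) ^ j) * (1 - X ^ (i + 1)) = 1 := fun i =>
    tsum_pow_mul_one_sub_of_constantCoeff_eq_zero (by simp)
  simp only [this] at h3
  exact h3.unique hasProd_one

open PowerSeries in
lemma pent_dvd (n : ℕ) : (X : (ZMod 11)⟦X⟧) ^ (n + 1) ∣ pentagonalSeries (ZMod 11) - qf X n := by
  rw [X_pow_dvd_iff]
  intro m hm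
  obtain ⟨s, hs⟩ := Filter.eventually_atTop.mp (coeff_prod_one_sub_X_pow_eventually_eq (ZMod 11) m)
  obtain ⟨M, hM⟩ := s.exists_nat_subset_range
  have := hs (Finset.range (max M n)) (hM.trans (Finset.range_mono (le_max_left _ _)))
  have h2 := X_pow_dvd_iff.mp (qf_dvd n (max M n) (le_max_right _ _)) m hm
  rw [map_sub] at *
  rw [← this]
  exact h2

open PowerSeries in
lemma PP_dvd (n : ℕ) : (X : (ZMod 11)⟦X⟧) ^ (n + 1) ∣ PP * qf X n - 1 := by
  have := (pent_dvd n).mul_left (-PP)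
  convert this using 1
  linear_combination PP_mul

open PowerSeries in
lemma gauss_dvd (n k : ℕ) (hk : k ≤ n) :
    (X : (ZMod 11)⟦X⟧) ^ (n - k + 1) ∣ gauss X (2 * n + 1) (n - k) * qf X n - 1 := by
  have h := gauss_mul (X : (ZMod 11)⟦X⟧) (2 * n + 1) (n - k) (n + k + 1) (by omega)
  have ha := qf_dvd (n - k) n (by omega)
  have hb := qf_dvd (n - k) (n + k + 1) (by omega)
  have hc := qf_dvd (n - k) (2 * n + 1) (by omega)
  have hp := PP_dvd (n - k)
  generalize gauss (X : (ZMod 11)⟦X⟧) (2 * n + 1) (n - k) = g at *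
  generalize (X : (ZMod 11)⟦X⟧) ^ (n - k + 1) = T at *
  obtain ⟨a, ha⟩ := ha
  obtain ⟨b, hb⟩ := hb
  obtain ⟨c, hc⟩ := hc
  obtain ⟨p, hp⟩ := hp
  -- `g u (u + T b) = u + T c`
  generalize qf (X : (ZMod 11)⟦X⟧) (n - k) = u at *
  rw [sub_eq_iff_eq_add] at ha hb hc
  rw [hb, hc] at h
  rw [ha]
  refine ⟨g * a + PP * (c - g * u * b) - p * (g * u - 1), ?_⟩
  linear_combination PP * h - (g * u - 1) * hp

open PowerSeries in
lemma jacobi (n : ℕ) : (X : (ZMod 11)⟦X⟧) ^ (n + 1) ∣ qf X n ^ 3 -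
    ∑ k ∈ Finset.range (n + 1), (-1) ^ k * (2 * (k : (ZMod 11)⟦X⟧) + 1) * X ^ ((k + 1).choose 2) := by
  have : Fact (Nat.Prime 11) := ⟨by norm_num⟩
  have h := jacobi_fin (X : (ZMod 11)⟦X⟧) X_ne_zero qf_ne_zero n
  rw [pow_succ (qf _ _), pow_two, ← h, Finset.sum_mul, ← Finset.sum_sub_distrib]
  apply Finset.dvd_sum
  intro k hk
  have hk : k ≤ n := by have := Finset.mem_range.mp hk; omega
  have hd := mul_dvd_mul_left (X ^ ((k + 1).choose 2)) (gauss_dvd n k hk)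
  rw [← pow_add] at hd
  have hc : k ≤ (k + 1).choose 2 := by rw [Nat.choose_succ_succ' k 1]; simp
  have h3 := ((pow_dvd_pow (X : (ZMod 11)⟦X⟧) (show n + 1 ≤ (k + 1).choose 2 + (n - k + 1) by omega)).trans
    hd).mul_left ((-1) ^ k * (2 * (k : (ZMod 11)⟦X⟧) + 1))
  convert h3 using 1
  ring

open PowerSeries in
lemma coeff_cube (n i : ℕ) (hi : i ≤ n) (h : i % 11 = 4) : coeff i (qf (X : (ZMod 11)⟦X⟧) n ^ 3) = 0 := by
  have : Fact (Nat.Prime 11) := ⟨by norm_num⟩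
  have h1 := X_pow_dvd_iff.mp (jacobi n) i (by omega)
  rw [map_sub, sub_eq_zero] at h1
  rw [h1, map_sum]
  apply Finset.sum_eq_zero
  intro k _
  have : (-1) ^ k * (2 * (k : (ZMod 11)⟦X⟧) + 1) * X ^ ((k + 1).choose 2) =
      C ((-1) ^ k * (2 * (k : ZMod 11) + 1)) * X ^ ((k + 1).choose 2) := by
    have h2 : (C (2 : ZMod 11) : (ZMod 11)⟦X⟧) = 2 := map_ofNat C 2
    simp [h2]
  rw [this, coeff_C_mul, coeff_X_pow]
  split_ifs with e
  · have h2 := choose_two_id (k + 1)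
    rw [← e] at h2
    have h3 : 8 * (i : ZMod 11) + 1 = (2 * (k : ZMod 11) + 1) ^ 2 := by
      have := congrArg (Nat.cast (R := ZMod 11)) h2
      push_cast at this
      linear_combination 4 * this
    have h4 : (i : ZMod 11) = 4 := by
      have := (ZMod.natCast_eq_natCast_iff' i 4 11).mpr (by omega)
      simpa using this
    rw [h4, show (8 * 4 + 1 : ZMod 11) = 0 from rfl] at h3
    have h5 := pow_eq_zero_iff (two_ne_zero) |>.mp h3.symm
    rw [h5]; simp
  · simp

open PowerSeries in
lemma coeff_PP11 (j : ℕ) (h : ¬ 11 ∣ j) : coeff j (PP ^ 11) = 0 := by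
  have : Fact (Nat.Prime 11) := ⟨by norm_num⟩
  have : ExpChar (ZMod 11) 11 := ExpChar.prime (by norm_num)
  have e : PowerSeries.map (frobenius (ZMod 11) 11) (PowerSeries.expand 11 (by norm_num) PP) = PP ^ 11 :=
    MvPowerSeries.map_frobenius_expand 11 (by norm_num)
  rw [← e, coeff_map, coeff_expand_of_not_dvd _ _ _ h, map_zero]

open PowerSeries in
lemma coeff_PP8 (n : ℕ) : coeff (11 * n + 4) (PP ^ 8) = 0 := by
  set M := 11 * n + 4 with hM
  have h : (X : (ZMod 11)⟦X⟧) ^ (M + 1) ∣ PP ^ 11 * qf X M ^ 3 - PP ^ 8 := by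
    have := (PP_dvd M).mul_left (PP ^ 8 * ((PP * qf X M) ^ 2 + PP * qf X M + 1))
    convert this using 1
    ring
  have h1 := X_pow_dvd_iff.mp h M (by omega)
  rw [map_sub, sub_eq_zero] at h1
  rw [← h1, coeff_mul]
  apply Finset.sum_eq_zero
  rintro ⟨a, b⟩ hab
  rw [Finset.HasAntidiagonal.mem_antidiagonal] at hab
  simp only at hab ⊢
  by_cases ha : 11 ∣ a
  · rw [coeff_cube M b (by omega) (by omega), mul_zero]
  · rw [coeff_PP11 a ha, zero_mul]

open PowerSeries in
lemma cast_multi (r n : ℕ) : (multipartition r n : ZMod 11) = coeff n (PP ^ r) := by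
  have : PP ^ r = ∏ _i : Fin r, PP := by simp
  rw [this, coeff_prod, multipartition, ← Finset.piAntidiag_univ_fin_eq_antidiagonalTuple]
  push_cast
  symm
  refine Finset.sum_bij (fun l _ => (l : Fin r → ℕ)) ?_ ?_ ?_ ?_
  · intro l hl
    simpa using hl
  · intro a _ b _ h
    exact DFunLike.coe_injective h
  · intro b hb
    refine ⟨Finsupp.equivFunOnFinite.symm b, ?_, by simp⟩
    simpa using hb
  · intro l _
    simp [PP]

theorem multipartition_eight_eleven (n : ℕ) : 11 ∣ multipartition 8 (11 * n + 4) := by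
  rw [← ZMod.natCast_eq_zero_iff, cast_multi, coeff_PP8]
end

section
/- For every nonnegative integer n, p_2(25n + 23) ≡ 0 (mod 25). -/
open PowerSeries in
lemma aux_genfun :
    (PowerSeries.mk fun n ↦ (Fintype.card (Nat.Partition n) : ℤ)) * pentagonalSeries ℤ = 1 := by
  let _ : TopologicalSpace ℤ := ⊥
  have _ : DiscreteTopology ℤ := ⟨rfl⟩
  open WithPiTopology in
  have h1 := Nat.Partition.hasProd_powerSeriesMk_card_restricted ℤ (fun _ ↦ True)
  have h2 := WithPiTopology.hasProd_one_sub_X_pow ℤ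
  have h3 := h1.mul h2
  have h4 : (fun i : ℕ ↦ (if True then ∑' j : ℕ, (X : ℤ⟦X⟧) ^ ((i + 1) * j) else 1) *
      (1 - X ^ (i + 1))) = fun _ ↦ 1 := by
    funext i
    simp only [if_true, pow_mul]
    exact WithPiTopology.tsum_pow_mul_one_sub_of_constantCoeff_eq_zero (by simp)
  rw [h4] at h3
  have h5 := h3.unique hasProd_one
  have h6 : ∀ n, (Nat.Partition.restricted n (fun _ ↦ True)).card
      = Fintype.card (Nat.Partition n) := by
    intro n
    simp [Nat.Partition.restricted]
  simpa only [h6] using h5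

/-- all exponents of `f` are congruent to `i` modulo `m` -/
def Cls (m i : ℕ) (f : PowerSeries ℤ) : Prop :=
  ∀ n, PowerSeries.coeff n f ≠ 0 → n ≡ i [MOD m]

lemma Cls.mul {m i j : ℕ} {f g : PowerSeries ℤ} (hf : Cls m i f) (hg : Cls m j g) :
    Cls m (i + j) (f * g) := by
  intro n hn
  rw [PowerSeries.coeff_mul] at hn
  obtain ⟨p, hp, h⟩ := Finset.exists_ne_zero_of_sum_ne_zero hn
  rw [← Finset.HasAntidiagonal.mem_antidiagonal.1 hp]
  exact (hf _ (left_ne_zero_of_mul h)).add (hg _ (right_ne_zero_of_mul h))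

lemma Cls.cast {m i j : ℕ} {f : PowerSeries ℤ} (hf : Cls m i f) (h : i % m = j % m) :
    Cls m j f := fun n hn ↦ (hf n hn).trans h

lemma Cls.add {m i : ℕ} {f g : PowerSeries ℤ} (hf : Cls m i f) (hg : Cls m i g) :
    Cls m i (f + g) := by
  intro n hn
  by_cases h : PowerSeries.coeff n f = 0
  · exact hg n (by simpa [h] using hn)
  · exact hf n h

lemma Cls.smul {m i : ℕ} {f : PowerSeries ℤ} (hf : Cls m i f) (c : ℤ) :
    Cls m i (PowerSeries.C c * f) := by
  intro n hn
  rw [PowerSeries.coeff_C_mul] at hn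
  exact hf n (right_ne_zero_of_mul hn)

lemma Cls.one (m : ℕ) : Cls m 0 1 := by
  intro n hn
  rw [PowerSeries.coeff_one] at hn
  have : n = 0 := by by_contra h; simp [h] at hn
  rw [this]

lemma Cls.pow {m i : ℕ} {f : PowerSeries ℤ} (hf : Cls m i f) (k : ℕ) :
    Cls m (i * k) (f ^ k) := by
  induction k with
  | zero => simpa using Cls.one m
  | succ k ih => rw [pow_succ, mul_add_one]; exact ih.mul hf

lemma Cls.coeff_zero {m i : ℕ} {f : PowerSeries ℤ} (hf : Cls m i f) (n : ℕ)
    (h : n % m ≠ i % m) : PowerSeries.coeff n f = 0 := by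
  by_contra h'
  exact h (hf n h')

/-- the part of the pentagonal series with exponents `r` mod 5 -/
noncomputable def prt (r : ℕ) : PowerSeries ℤ :=
  PowerSeries.mk fun n ↦ if n % 5 = r then PowerSeries.coeff n (PowerSeries.pentagonalSeries ℤ) else 0

lemma prt_cls (r : ℕ) (hr : r < 5) : Cls 5 r (prt r) := by
  intro n hn
  have : n % 5 = r := by by_contra h; simp [prt, h] at hn
  rw [Nat.ModEq, this, Nat.mod_eq_of_lt hr]

lemma pent_mod (k : ℤ) : (k % 5 = 0 ∧ pentagonal k % 5 = 0) ∨ (k % 5 = 1 ∧ pentagonal k % 25 = 1) ∨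
    (k % 5 = 2 ∧ pentagonal k % 5 = 0) ∨ (k % 5 = 3 ∧ pentagonal k % 5 = 2) ∨
    (k % 5 = 4 ∧ pentagonal k % 5 = 2) := by
  have h := two_mul_natCast_pentagonal k
  obtain ⟨j, r, hk, h0, h5⟩ : ∃ j r : ℤ, k = 5 * j + r ∧ 0 ≤ r ∧ r < 5 :=
    ⟨k / 5, k % 5, by omega, by omega, by omega⟩
  have h2 : (j * (3 * j + 1)) % 2 = 0 := by
    rcases Int.emod_two_eq_zero_or_one j with h | h <;> simp [Int.mul_emod, Int.add_emod, h]
  obtain ⟨t, ht⟩ : ∃ t, t = j * j := ⟨_, rfl⟩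
  have h3 : j * (3 * j + 1) = 3 * t + j := by rw [ht]; ring
  rw [h3] at h2
  have h4 : 2 * (pentagonal k : ℤ) = 75 * t - 5 * j + 30 * (j * r) + r * (3 * r - 1) := by
    rw [h, hk, ht]; ring
  generalize pentagonal k = P at h4
  clear h h3 ht
  interval_cases r
  · left; omega
  · right; left; omega
  · right; right; left; omega
  · right; right; right; left; omega
  · right; right; right; right; omega

lemma prt_one_cls : Cls 25 1 (prt 1) := by
  intro n hn
  by_cases h1 : n % 5 = 1
  · simp only [prt, PowerSeries.coeff_mk, h1, if_true] at hn
    rw [Ne, PowerSeries.coeff_pentagonalSeries_eq_zero_iff, not_not] at hn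
    obtain ⟨k, rfl⟩ := hn
    have := pent_mod k
    unfold Nat.ModEq
    omega
  · simp [prt, h1] at hn

lemma prt_sum : PowerSeries.pentagonalSeries ℤ = prt 0 + prt 1 + prt 2 := by
  ext n
  by_cases h : n ∈ Set.range pentagonal
  · obtain ⟨k, rfl⟩ := h
    simp only [prt, map_add, PowerSeries.coeff_mk]
    have := pent_mod k
    have : pentagonal k % 5 = 0 ∨ pentagonal k % 5 = 1 ∨ pentagonal k % 5 = 2 := by omega
    rcases this with h | h | h <;> simp [h]
  · simp [prt, PowerSeries.coeff_pentagonalSeries_eq_zero ℤ h]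

/-- index set of pairs -/
noncomputable def TT (n : ℕ) : Finset (ℤ × ℤ) :=
  (Finset.HasAntidiagonal.antidiagonal n).preimage (Prod.map pentagonal pentagonal)
    ((pentagonal_injective.prodMap pentagonal_injective).injOn)

lemma mem_TT {n : ℕ} {x : ℤ × ℤ} : x ∈ TT n ↔ pentagonal x.1 + pentagonal x.2 = n := by
  simp [TT]

lemma TT_sum (n : ℕ) (w : ℕ → ℕ → ℤ) :
    ∑ x ∈ TT n, w (pentagonal x.1) (pentagonal x.2) * (Int.negOnePow x.1 * Int.negOnePow x.2 : ℤ) =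
    ∑ p ∈ Finset.HasAntidiagonal.antidiagonal n, w p.1 p.2 *
      (PowerSeries.coeff p.1 (PowerSeries.pentagonalSeries ℤ) *
      PowerSeries.coeff p.2 (PowerSeries.pentagonalSeries ℤ)) := by
  rw [← Finset.sum_preimage (Prod.map pentagonal pentagonal) (Finset.HasAntidiagonal.antidiagonal n)
    ((pentagonal_injective.prodMap pentagonal_injective).injOn)]
  · refine Finset.sum_congr rfl fun x _ ↦ ?_
    simp only [Prod.map_fst, Prod.map_snd, PowerSeries.coeff_pentagonalSeries_pentagonal,
      Int.cast_id]
  · rintro ⟨a, b⟩ _ h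
    simp only [Set.range_prodMap, Set.mem_prod, not_and_or] at h
    rcases h with h | h <;> simp [PowerSeries.coeff_pentagonalSeries_eq_zero ℤ h]

lemma TT_invol (n : ℕ) :
    ∑ x ∈ TT n, (if (3 * x.1 + 4 * x.2) % 5 = 2 then 1 else 0) *
      (Int.negOnePow x.1 * Int.negOnePow x.2 : ℤ) = 0 := by
  simp only [ite_mul, one_mul, zero_mul]
  rw [← Finset.sum_filter]
  have key : ∀ x : ℤ × ℤ, (3 * x.1 + 4 * x.2) % 5 = 2 → ∃ a b : ℤ,
      (-3 * x.1 - 4 * x.2 + 2) / 5 = a ∧ (-4 * x.1 + 3 * x.2 + 1) / 5 = b ∧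
      5 * a = -3 * x.1 - 4 * x.2 + 2 ∧ 5 * b = -4 * x.1 + 3 * x.2 + 1 := by
    intro x hx
    refine ⟨_, _, rfl, rfl, ?_, ?_⟩ <;> omega
  have sgn : ∀ a b c d : ℤ, (a + b + c + d) % 2 = 1 →
      (Int.negOnePow a * Int.negOnePow b : ℤ) + (Int.negOnePow c * Int.negOnePow d : ℤ) = 0 := by
    intro a b c d h
    have h' : c + d = (a + b + c + d) - (a + b) := by ring
    have h1 : Int.negOnePow (a + b + c + d) = -1 := Int.negOnePow_odd _ (Int.odd_iff.2 h)
    have : Int.negOnePow (c + d) = - Int.negOnePow (a + b) := by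
      rw [h', Int.negOnePow_sub, h1]; simp
    have := congrArg (Units.val) this
    simp only [Int.negOnePow_add, Units.val_neg, Units.val_mul] at this
    linarith
  refine Finset.sum_involution
    (fun x _ ↦ ((-3 * x.1 - 4 * x.2 + 2) / 5, (-4 * x.1 + 3 * x.2 + 1) / 5)) ?_ ?_ ?_ ?_
  · intro x hx
    obtain ⟨a, b, ha, hb, h1, h2⟩ := key x (Finset.mem_filter.1 hx).2
    simp only [ha, hb]
    apply sgn
    omega
  · intro x hx _ he
    obtain ⟨a, b, ha, hb, h1, h2⟩ := key x (Finset.mem_filter.1 hx).2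
    rw [ha, hb] at he
    have e1 : a = x.1 := congrArg Prod.fst he
    have e2 : b = x.2 := congrArg Prod.snd he
    omega
  · intro x hx
    obtain ⟨hT, hc⟩ := Finset.mem_filter.1 hx
    obtain ⟨a, b, ha, hb, h1, h2⟩ := key x hc
    rw [mem_TT] at hT
    rw [ha, hb, Finset.mem_filter, mem_TT]
    refine ⟨?_, by dsimp only; omega⟩
    have p1 := two_mul_natCast_pentagonal x.1
    have p2 := two_mul_natCast_pentagonal x.2
    have p3 := two_mul_natCast_pentagonal a
    have p4 := two_mul_natCast_pentagonal b
    dsimp only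
    have : x.1 * (3 * x.1 - 1) + x.2 * (3 * x.2 - 1) = a * (3 * a - 1) + b * (3 * b - 1) := by
      have e1 : x.1 = (-3 * a - 4 * b + 2) / 5 := by omega
      obtain ⟨e1, e2⟩ : 5 * x.1 = -3 * a - 4 * b + 2 ∧ 5 * x.2 = -4 * a + 3 * b + 1 := by omega
      have : 25 * (x.1 * (3 * x.1 - 1) + x.2 * (3 * x.2 - 1)) =
        25 * (a * (3 * a - 1) + b * (3 * b - 1)) := by
        have : 25 * (x.1 * (3 * x.1 - 1) + x.2 * (3 * x.2 - 1)) =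
          (5 * x.1) * (3 * (5 * x.1) - 5) + (5 * x.2) * (3 * (5 * x.2) - 5) := by ring
        rw [this, e1, e2]; ring
      linarith
    omega
  · intro x hx
    obtain ⟨a, b, ha, hb, h1, h2⟩ := key x (Finset.mem_filter.1 hx).2
    simp only [ha, hb]
    ext <;> dsimp only <;> omega

lemma TT_invol' (n : ℕ) :
    ∑ x ∈ TT n, (if (3 * x.2 + 4 * x.1) % 5 = 2 then 1 else 0) *
      (Int.negOnePow x.1 * Int.negOnePow x.2 : ℤ) = 0 := by
  refine Eq.trans ?_ (TT_invol n)
  refine Finset.sum_nbij' Prod.swap Prod.swap ?_ ?_ ?_ ?_ ?_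
  · intro x hx; rw [mem_TT] at *; simp; omega
  · intro x hx; rw [mem_TT] at *; simp; omega
  · simp
  · simp
  · intro x hx; simp [mul_comm]

lemma prt_coeff_mul (n r s : ℕ) : PowerSeries.coeff n (prt r * prt s) =
    ∑ x ∈ TT n, (if pentagonal x.1 % 5 = r ∧ pentagonal x.2 % 5 = s then 1 else 0) *
      (Int.negOnePow x.1 * Int.negOnePow x.2 : ℤ) := by
  rw [TT_sum n (fun i j ↦ if i % 5 = r ∧ j % 5 = s then 1 else 0), PowerSeries.coeff_mul]
  refine Finset.sum_congr rfl fun p _ ↦ ?_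
  simp only [prt, PowerSeries.coeff_mk]
  by_cases h1 : p.1 % 5 = r <;> by_cases h2 : p.2 % 5 = s <;> simp [h1, h2]

lemma prt_rel : prt 0 * prt 2 = - prt 1 ^ 2 := by
  have h : prt 0 * prt 2 + prt 2 * prt 0 + (prt 1 * prt 1 + prt 1 * prt 1) = 0 := by
    ext n
    simp only [map_add, prt_coeff_mul, map_zero]
    rw [← Finset.sum_add_distrib, ← Finset.sum_add_distrib, ← Finset.sum_add_distrib]
    have e := congrArg₂ (· + ·) (TT_invol n) (TT_invol' n)
    simp only [add_zero] at e
    rw [← Finset.sum_add_distrib] at e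
    refine Eq.trans ?_ e
    refine Finset.sum_congr rfl fun x _ ↦ ?_
    rw [← add_mul, ← add_mul, ← add_mul, ← add_mul]
    congr 1
    have h1 := pent_mod x.1
    have h2 := pent_mod x.2
    generalize pentagonal x.1 = P at *
    generalize pentagonal x.2 = Q at *
    split_ifs <;> omega
  have h2 : (2 : PowerSeries ℤ) * (prt 0 * prt 2 + prt 1 ^ 2) = 0 := by
    rw [← h]; ring
  have h3 : prt 0 * prt 2 + prt 1 ^ 2 = 0 := by
    ext n
    have := congrArg (PowerSeries.coeff n) h2
    rw [two_mul, map_add] at this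
    rw [map_zero] at *
    omega
  exact eq_neg_of_add_eq_zero_left h3

lemma prt_const : PowerSeries.constantCoeff (prt 0) = 1 ∧
    PowerSeries.constantCoeff (prt 1) = 0 ∧ PowerSeries.constantCoeff (prt 2) = 0 := by
  simp only [← PowerSeries.coeff_zero_eq_constantCoeff_apply, prt, PowerSeries.coeff_mk]
  have := PowerSeries.coeff_pentagonalSeries_pentagonal ℤ 0
  simpa [pentagonal] using this

lemma inv_cls (D : PowerSeries ℤ) (hD : Cls 5 0 D) (h1 : PowerSeries.constantCoeff D = 1) :
    ∃ U, U * D = 1 ∧ Cls 5 0 U := by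
  let D' : PowerSeries ℤ := PowerSeries.mk fun n ↦ PowerSeries.coeff (5 * n) D
  have hD' : PowerSeries.expand 5 (by norm_num) D' = D := by
    ext n
    rw [PowerSeries.coeff_expand]
    split_ifs with h
    · obtain ⟨k, rfl⟩ := h
      simp [D']
    · exact (hD.coeff_zero n (by omega)).symm
  refine ⟨PowerSeries.expand 5 (by norm_num) (PowerSeries.invOfUnit D' 1), ?_, ?_⟩
  · conv_lhs => rw [← hD']
    rw [← map_mul, mul_comm, PowerSeries.mul_invOfUnit, map_one]
    simp [D', ← PowerSeries.coeff_zero_eq_constantCoeff_apply, h1] at h1 ⊢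
  · intro n hn
    rw [PowerSeries.coeff_expand] at hn
    have : 5 ∣ n := by by_contra h; simp [h] at hn
    unfold Nat.ModEq; omega

lemma pow_five (f : PowerSeries (ZMod 5)) : f ^ 5 = PowerSeries.expand 5 (by norm_num) f := by
  have : Fact (Nat.Prime 5) := ⟨by norm_num⟩
  have := MvPowerSeries.map_frobenius_expand (σ := Unit) (R := ZMod 5) 5 (by norm_num) (f := f)
  rw [ZMod.frobenius_zmod] at this
  rw [← this]
  exact PowerSeries.map_id (R := ZMod 5) ▸ rfl

lemma C_nat (c : ℤ) : (PowerSeries.C c : PowerSeries ℤ) = (c : PowerSeries ℤ) := by simp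

theorem multipartition_two_twentyfive (n : ℕ) : 25 ∣ multipartition 2 (25 * n + 23) := by
  obtain ⟨F, hF⟩ : ∃ F : PowerSeries ℤ, F =
    PowerSeries.mk fun n ↦ (Fintype.card (Nat.Partition n) : ℤ) := ⟨_, rfl⟩
  have hFE := aux_genfun
  rw [← hF, prt_sum] at hFE
  have hG : (multipartition 2 (25 * n + 23) : ℤ) = PowerSeries.coeff (25 * n + 23) (F * F) := by
    rw [PowerSeries.coeff_mul, hF]
    simp [multipartition, Finset.Nat.antidiagonalTuple_two, Fin.prod_univ_two]
  have cA := prt_cls 0 (by norm_num)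
  have cB := prt_cls 1 (by norm_num)
  have cK := prt_cls 2 (by norm_num)
  have cB' := prt_one_cls
  have rel := prt_rel
  obtain ⟨kA, kB, kK⟩ := prt_const
  generalize prt 0 = A at *
  generalize prt 1 = B at *
  generalize prt 2 = K at *
  obtain ⟨D, hD⟩ : ∃ D, D = A ^ 5 + PowerSeries.C 11 * B ^ 5 + K ^ 5 := ⟨_, rfl⟩
  have cD : Cls 5 0 D := by
    rw [hD]
    exact (((cA.pow 5).cast (by norm_num)).add (((cB.pow 5).smul 11).cast (by norm_num))).add
      ((cK.pow 5).cast (by norm_num))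
  obtain ⟨U, hU, cU⟩ := inv_cls D cD (by rw [hD]; simp [kA, kB, kK])
  obtain ⟨P0, hP0⟩ : ∃ x, x = A ^ 4 + PowerSeries.C (-3) * (B ^ 3 * K) := ⟨_, rfl⟩
  obtain ⟨P1, hP1⟩ : ∃ x, x = PowerSeries.C (-1) * (A ^ 3 * B) + PowerSeries.C 2 * (B ^ 2 * K ^ 2) :=
    ⟨_, rfl⟩
  obtain ⟨P2, hP2⟩ : ∃ x, x = PowerSeries.C 2 * (A ^ 2 * B ^ 2) + PowerSeries.C (-1) * (B * K ^ 3) :=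
    ⟨_, rfl⟩
  obtain ⟨P3, hP3⟩ : ∃ x, x = PowerSeries.C (-3) * (A * B ^ 3) + K ^ 4 := ⟨_, rfl⟩
  obtain ⟨P4, hP4⟩ : ∃ x, x = PowerSeries.C 5 * B ^ 4 := ⟨_, rfl⟩
  have c0 : Cls 5 0 P0 := by
    rw [hP0]
    exact ((cA.pow 4).cast (by norm_num)).add ((((cB.pow 3).mul cK).smul _).cast (by norm_num))
  have c1 : Cls 5 1 P1 := by
    rw [hP1]
    exact ((((cA.pow 3).mul cB).smul _).cast (by norm_num)).add
      ((((cB.pow 2).mul (cK.pow 2)).smul _).cast (by norm_num))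
  have c2 : Cls 5 2 P2 := by
    rw [hP2]
    exact ((((cA.pow 2).mul (cB.pow 2)).smul _).cast (by norm_num)).add
      (((cB.mul (cK.pow 3)).smul _).cast (by norm_num))
  have c3 : Cls 5 3 P3 := by
    rw [hP3]
    exact (((cA.mul (cB.pow 3)).smul _).cast (by norm_num)).add ((cK.pow 4).cast (by norm_num))
  have c4 : Cls 5 4 P4 := by
    rw [hP4]
    exact ((cB.pow 4).smul _).cast (by norm_num)
  have hP : (A + B + K) * (P0 + P1 + P2 + P3 + P4) = D := by
    rw [hP0, hP1, hP2, hP3, hP4, hD]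
    simp only [C_nat]
    push_cast
    linear_combination (A ^ 3 - 6 * B ^ 3 - A ^ 2 * B + 2 * B ^ 2 * K + 2 * A * B ^ 2 - B * K ^ 2
      + K ^ 3) * rel
  have hQ : P0 * P3 + P0 * P3 + (P1 * P2 + P1 * P2) + P4 * P4 =
      PowerSeries.C (-10) * (B ^ 3 * D) + PowerSeries.C 125 * B ^ 8 := by
    rw [hP0, hP1, hP2, hP3, hP4, hD]
    simp only [C_nat]
    push_cast
    linear_combination (2 * A ^ 3 * K ^ 3 + 10 * B ^ 6 + 8 * A * B ^ 4 * K) * rel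
  have hFU : F = U * (P0 + P1 + P2 + P3 + P4) := by
    linear_combination (-F) * hU + F * U * hP.symm + (U * (P0 + P1 + P2 + P3 + P4)) * hFE
  -- Ramanujan's congruence
  have ram : ∀ m, (5 : ℤ) ∣ PowerSeries.coeff (5 * m + 4) F := by
    intro m
    have e : F = U * P0 + U * P1 + U * P2 + U * P3 + PowerSeries.C 5 * (U * B ^ 4) := by
      rw [hFU, hP4]; ring
    rw [e]
    simp only [map_add, PowerSeries.coeff_C_mul]
    rw [(cU.mul c0).coeff_zero _ (by omega), (cU.mul c1).coeff_zero _ (by omega),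
      (cU.mul c2).coeff_zero _ (by omega), (cU.mul c3).coeff_zero _ (by omega)]
    simp
  have hU5 : ∀ m, (5 : ℤ) ∣ PowerSeries.coeff (25 * m + 20) U := by
    intro m
    have f1 := congrArg (PowerSeries.map (Int.castRingHom (ZMod 5))) hU
    have f2 := congrArg (PowerSeries.map (Int.castRingHom (ZMod 5))) hFE
    have e11 : Int.castRingHom (ZMod 5) 11 = 1 := by decide
    rw [hD] at f1
    simp only [map_mul, map_add, map_pow, map_one, PowerSeries.map_C, e11] at f1 f2
    have f3 := congrArg (· ^ 5) f2
    simp only [mul_pow, one_pow] at f3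
    rw [pow_five (_ + _ + _), map_add, map_add, ← pow_five, ← pow_five, ← pow_five] at f3
    rw [one_mul] at f1
    have f4 : PowerSeries.map (Int.castRingHom (ZMod 5)) U =
        PowerSeries.map (Int.castRingHom (ZMod 5)) F ^ 5 := by
      generalize PowerSeries.map (Int.castRingHom (ZMod 5)) U = u at *
      generalize PowerSeries.map (Int.castRingHom (ZMod 5)) F = v at *
      linear_combination v ^ 5 * f1 - u * f3
    rw [pow_five] at f4
    have f5 := congrArg (PowerSeries.coeff (5 * (5 * m + 4))) f4
    rw [PowerSeries.coeff_expand_mul, PowerSeries.coeff_map, PowerSeries.coeff_map] at f5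
    have f6 := (ZMod.intCast_zmod_eq_zero_iff_dvd _ 5).2 (ram m)
    rw [show 25 * m + 20 = 5 * (5 * m + 4) by ring]
    apply (ZMod.intCast_zmod_eq_zero_iff_dvd _ 5).1
    exact f5.trans f6
  have hUB : (5 : ℤ) ∣ PowerSeries.coeff (25 * n + 23) (U * B ^ 3) := by
    rw [PowerSeries.coeff_mul]
    refine Finset.dvd_sum fun p hp ↦ ?_
    rw [Finset.HasAntidiagonal.mem_antidiagonal] at hp
    by_cases h : p.2 % 25 = 3
    · obtain ⟨m, hm⟩ : ∃ m, p.1 = 25 * m + 20 := ⟨p.1 / 25, by omega⟩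
      rw [hm]
      exact (hU5 m).mul_right _
    · rw [(cB'.pow 3).coeff_zero p.2 (by omega)]
      simp
  have hFF : F * F = U * U * (P0 * P0 + (P1 * P4 + P1 * P4) + (P2 * P3 + P2 * P3))
      + U * U * (P3 * P3 + (P0 * P1 + P0 * P1) + (P2 * P4 + P2 * P4))
      + U * U * (P1 * P1 + (P0 * P2 + P0 * P2) + (P3 * P4 + P3 * P4))
      + U * U * (P2 * P2 + (P0 * P4 + P0 * P4) + (P1 * P3 + P1 * P3))
      + (PowerSeries.C (-10) * (U * B ^ 3) + PowerSeries.C 125 * (U * U * B ^ 8)) := by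
    rw [hFU]
    linear_combination (U * U) * hQ + PowerSeries.C (-10) * U * B ^ 3 * hU
  have q0 : Cls 5 0 (U * U * (P0 * P0 + (P1 * P4 + P1 * P4) + (P2 * P3 + P2 * P3))) :=
    (cU.mul cU).mul (((c0.mul c0).add (((c1.mul c4).add (c1.mul c4)).cast (by norm_num))).add
      (((c2.mul c3).add (c2.mul c3)).cast (by norm_num)))
  have q1 : Cls 5 1 (U * U * (P3 * P3 + (P0 * P1 + P0 * P1) + (P2 * P4 + P2 * P4))) :=
    ((cU.mul cU).mul (((c3.mul c3).add (((c0.mul c1).add (c0.mul c1)).cast (by norm_num))).add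
      (((c2.mul c4).add (c2.mul c4)).cast (by norm_num)))).cast (by norm_num)
  have q2 : Cls 5 2 (U * U * (P1 * P1 + (P0 * P2 + P0 * P2) + (P3 * P4 + P3 * P4))) :=
    ((cU.mul cU).mul (((c1.mul c1).add (((c0.mul c2).add (c0.mul c2)).cast (by norm_num))).add
      (((c3.mul c4).add (c3.mul c4)).cast (by norm_num)))).cast (by norm_num)
  have q4 : Cls 5 4 (U * U * (P2 * P2 + (P0 * P4 + P0 * P4) + (P1 * P3 + P1 * P3))) :=
    ((cU.mul cU).mul (((c2.mul c2).add (((c0.mul c4).add (c0.mul c4)).cast (by norm_num))).add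
      (((c1.mul c3).add (c1.mul c3)).cast (by norm_num)))).cast (by norm_num)
  have : (25 : ℤ) ∣ (multipartition 2 (25 * n + 23) : ℤ) := by
    rw [hG, hFF]
    simp only [map_add]
    rw [q0.coeff_zero _ (by omega), q1.coeff_zero _ (by omega), q2.coeff_zero _ (by omega),
      q4.coeff_zero _ (by omega), PowerSeries.coeff_C_mul, PowerSeries.coeff_C_mul]
    omega
  exact_mod_cast this
end
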